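/- Let p be a prime, n ≥ 1, and let R → R' be a faithfully flat homomorphism of semiperfect 𝔽_p-algebras. For a commutative ring S, let W(S)[Fⁿ] denote the kernel of the n-th iterate of the Witt vector Frobenius F on W(S). Then the augmented Čech complex W(R)[Fⁿ] → W(R')[Fⁿ] → W(R' ⊗_R R')[Fⁿ] → ⋯ is acyclic (exact at every term). -/

import Mathlib

/-!
STATEMENT 5: Let p be a prime, n ≥ 1, and let R → R' be a faithfully flat
homomorphism of semiperfect 𝔽_p-algebras.  Then the augmented Čech complex
W(R)[Fⁿ] → W(R')[Fⁿ] → W(R' ⊗_R R')[Fⁿ] → ⋯ of kernels of the n-th iterated Witt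
vector Frobenius is acyclic (exact at every term).
-/

open TensorProduct

universe u

/-- A bundled commutative `R`-algebra. -/
structure CommAlgebraBundle (R : Type u) [CommRing R] : Type (u + 1) where
  carrier : Type u
  [commRing : CommRing carrier]
  [algebra : Algebra R carrier]

attribute [instance] CommAlgebraBundle.commRing CommAlgebraBundle.algebra

variable {R : Type u} [CommRing R]

/-- `cechAlg R' n` is the `(n+1)`-fold tensor power `R' ⊗_R ⋯ ⊗_R R'`. -/
noncomputable def cechAlg (R' : Type u) [CommRing R'] [Algebra R R'] : ℕ → CommAlgebraBundle R
  | 0 => CommAlgebraBundle.mk R'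
  | n + 1 => CommAlgebraBundle.mk ((cechAlg R' n).carrier ⊗[R] R')

/-- The `R`-algebra map inserting `1` into the `i`-th tensor position. -/
noncomputable def cechIns (R' : Type u) [CommRing R'] [Algebra R R'] :
    (n : ℕ) → Fin (n + 2) →
      ((cechAlg (R := R) R' n).carrier →ₐ[R] (cechAlg (R := R) R' (n + 1)).carrier)
  | 0, i =>
      Fin.cases Algebra.TensorProduct.includeRight
        (fun _ => Algebra.TensorProduct.includeLeft) i
  | n + 1, i =>
      Fin.lastCases Algebra.TensorProduct.includeLeft
        (fun j => Algebra.TensorProduct.map (cechIns R' n j) (AlgHom.id R R')) i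

/-- The Čech differential, the alternating sum of the maps induced by inserting `1`
into the possible tensor positions. -/
noncomputable def cechWittD (p : ℕ) [Fact p.Prime] (R' : Type u) [CommRing R'] [Algebra R R']
    (n : ℕ) :
    WittVector p (cechAlg (R := R) R' n).carrier →+
      WittVector p (cechAlg (R := R) R' (n + 1)).carrier :=
  ∑ i : Fin (n + 2),
    (-1 : ℤ) ^ (i : ℕ) •
      (WittVector.map (p := p) ((cechIns (R := R) R' n i) : _ →+* _)).toAddMonoidHom

/-- Membership in `W(S)[Fⁿ]`, the kernel of the n-th iterate of the Witt vector
Frobenius. -/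
def InKerFrobeniusPow (p : ℕ) [Fact p.Prime] {S : Type u} [CommRing S] (n : ℕ)
    (x : WittVector p S) : Prop :=
  (⇑(WittVector.frobenius (p := p) (R := S)))^[n] x = 0

/-! ### Generic lemmas on alternating sums -/

theorem cechAux_dd {A B C : Type*} [AddCommGroup A] [AddCommGroup B] [AddCommGroup C] (m : ℕ)
    (f : Fin (m + 2) → A →+ B) (g : Fin (m + 3) → B →+ C)
    (h : ∀ i j : Fin (m + 2), i ≤ j → ∀ x, g j.succ (f i x) = g i.castSucc (f j x)) (x : A) :
    (∑ j : Fin (m + 3), (-1 : ℤ) ^ (j : ℕ) • g j)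
      ((∑ i : Fin (m + 2), (-1 : ℤ) ^ (i : ℕ) • f i) x) = 0 := by
  simp only [AddMonoidHom.finsetSum_apply, AddMonoidHom.smul_apply, map_sum, map_zsmul,
    Finset.smul_sum]
  rw [← Finset.sum_product']
  let P := Fin (m + 2) × Fin (m + 3)
  let S : Finset P := {ij : P | (ij.2 : ℕ) ≤ (ij.1 : ℕ)}
  rw [Finset.univ_product_univ, ← Finset.sum_add_sum_compl S, ← eq_neg_iff_add_eq_zero,
    ← Finset.sum_neg_distrib]
  let φ : ∀ ij : P, ij ∈ S → P := fun ij hij =>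
    (Fin.castLT ij.2 (lt_of_le_of_lt (Finset.mem_filter.mp hij).right (Fin.is_lt ij.1)), ij.1.succ)
  apply Finset.sum_bij φ
  · intro ij hij
    simp_rw [S, φ, Finset.compl_filter, Finset.mem_filter_univ, Fin.val_succ,
      Fin.val_castLT] at hij ⊢
    lia
  · rintro ⟨i, j⟩ hij ⟨i', j'⟩ hij' h
    rw [Prod.mk_inj]
    exact ⟨by simpa [φ] using! congr_arg Prod.snd h,
      by simpa [φ, Fin.castSucc_castLT] using! congr_arg Fin.castSucc (congr_arg Prod.fst h)⟩
  · rintro ⟨i', j'⟩ hij'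
    simp_rw [S, Finset.compl_filter, Finset.mem_filter_univ, not_le] at hij'
    refine ⟨(j'.pred <| ?_, Fin.castSucc i'), ?_, ?_⟩
    · rintro rfl
      simp only [Fin.val_zero, not_lt_zero] at hij'
    · simpa [S] using! Nat.le_sub_one_of_lt hij'
    · simp only [φ, Fin.castLT_castSucc, Fin.succ_pred]
  · rintro ⟨i, j⟩ hij
    have hle : (j : ℕ) ≤ (i : ℕ) := by simpa [S] using! hij
    have hj : (j : ℕ) < m + 2 := lt_of_le_of_lt hle i.is_lt
    have key := h (Fin.castLT j hj) i (by simpa [Fin.le_def] using hle) x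
    rw [Fin.castSucc_castLT] at key
    simp only [φ, key, Fin.val_succ, Fin.val_castLT, smul_smul, ← neg_smul]
    congr 1
    ring


section Witt

variable {p : ℕ} [Fact p.Prime]

theorem cechAux_split {A : Type*} [CommRing A] (f : ℕ → A) :
    WittVector.mk p f = WittVector.teichmuller p (f 0)
      + WittVector.verschiebung (WittVector.mk p fun i => f (i + 1)) := by
  ext n
  rw [WittVector.coeff_add_of_disjoint]
  · cases n with
    | zero => simp
    | succ n => simp [WittVector.verschiebung_coeff_succ]
  · intro n
    cases n with
    | zero => right; simp
    | succ n => left; simp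

theorem cechAux_eq_versch {A : Type*} [CommRing A] (x : WittVector p A) (h : x.coeff 0 = 0) :
    x = WittVector.verschiebung (x.shift 1) := by
  simpa using WittVector.eq_iterate_verschiebung (x := x) (n := 1) (by simp [h])

theorem cechAux_witt_inj {A B : Type*} [CommRing A] [CommRing B]
    (D : WittVector p A →+ WittVector p B) (d : A → B)
    (hd : ∀ a, d a = 0 → a = 0)
    (h0 : ∀ x, (D x).coeff 0 = d (x.coeff 0))
    (hV : ∀ x, D (WittVector.verschiebung x) = WittVector.verschiebung (D x))
    (x : WittVector p A) (hx : D x = 0) : x = 0 := by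
  have key : ∀ n (x : WittVector p A), D x = 0 → x.coeff n = 0 := by
    intro n
    induction n with
    | zero => intro x hx; exact hd _ (by rw [← h0, hx]; simp)
    | succ n ih =>
      intro x hx
      have h1 : x.coeff 0 = 0 := hd _ (by rw [← h0, hx]; simp)
      have h2 := cechAux_eq_versch x h1
      rw [h2, WittVector.verschiebung_coeff_succ]
      apply ih
      rw [h2, hV] at hx
      exact WittVector.verschiebung_injective p B (by rw [hx, map_zero])
  ext n
  rw [key n x hx, WittVector.zero_coeff]

theorem cechAux_witt_exact {A B C : Type*} [CommRing A] [CommRing B] [CommRing C]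
    (D : WittVector p A →+ WittVector p B) (E : WittVector p B →+ WittVector p C)
    (d : A → B) (e : B → C)
    (hex : ∀ b, e b = 0 → ∃ a, d a = b)
    (hD0 : ∀ x, (D x).coeff 0 = d (x.coeff 0))
    (hE0 : ∀ x, (E x).coeff 0 = e (x.coeff 0))
    (hDV : ∀ x, D (WittVector.verschiebung x) = WittVector.verschiebung (D x))
    (hEV : ∀ x, E (WittVector.verschiebung x) = WittVector.verschiebung (E x))
    (hED : ∀ x, E (D x) = 0)
    (x : WittVector p B) (hx : E x = 0) : ∃ y, D y = x := by
  have step : ∀ z : {z : WittVector p B // E z = 0},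
      ∃ (a : A) (w : {z : WittVector p B // E z = 0}),
        z.1 = D (WittVector.teichmuller p a) + WittVector.verschiebung w.1 := by
    rintro ⟨z, hz⟩
    obtain ⟨a, ha⟩ := hex (z.coeff 0) (by rw [← hE0, hz, WittVector.zero_coeff])
    have h0 : (z - D (WittVector.teichmuller p a)).coeff 0 = 0 := by
      have : ∀ u v : WittVector p B, (u - v).coeff 0 = u.coeff 0 - v.coeff 0 := fun u v =>
        map_sub (WittVector.constantCoeff (p := p) (R := B)) u v
      rw [this, hD0, WittVector.teichmuller_coeff_zero, ha, sub_self]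
    have h1 := cechAux_eq_versch _ h0
    refine ⟨a, ⟨(z - D (WittVector.teichmuller p a)).shift 1, ?_⟩, ?_⟩
    · apply WittVector.verschiebung_injective p C
      rw [← hEV, ← h1, map_sub, hz, hED, sub_zero, map_zero]
    · change z = D (WittVector.teichmuller p a) + _
      rw [← h1]; abel
  choose a w hw using step
  let xs : ℕ → {z : WittVector p B // E z = 0} := fun k => Nat.rec ⟨x, hx⟩ (fun _ z => w z) k
  have hxs : ∀ k, (xs k).1 = D (WittVector.teichmuller p (a (xs k)))
      + WittVector.verschiebung (xs (k + 1)).1 := fun k => hw (xs k)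
  let Y : ℕ → WittVector p A := fun k => WittVector.mk p fun i => a (xs (k + i))
  have hY : ∀ k, Y k = WittVector.teichmuller p (a (xs k)) + WittVector.verschiebung (Y (k + 1)) := by
    intro k
    have := cechAux_split (p := p) (fun i => a (xs (k + i)))
    simp only [Y]
    rw [this]
    congr 3
    ext i
    rw [show k + 1 + i = k + (i + 1) by ring]
  have hdiff : ∀ k, (xs k).1 - D (Y k) = WittVector.verschiebung ((xs (k + 1)).1 - D (Y (k + 1))) := by
    intro k
    conv_lhs => rw [hxs k, hY k]
    rw [map_add, hDV, map_sub]
    abel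
  have hc : ∀ n k, ((xs k).1 - D (Y k)).coeff n = 0 := by
    intro n
    induction n with
    | zero => intro k; rw [hdiff k]; exact WittVector.verschiebung_coeff_zero _
    | succ n ih => intro k; rw [hdiff k, WittVector.verschiebung_coeff_succ]; exact ih (k + 1)
  refine ⟨Y 0, ?_⟩
  have : (xs 0).1 - D (Y 0) = 0 := by
    ext n; rw [hc, WittVector.zero_coeff]
  exact (sub_eq_zero.mp this).symm

theorem cechAux_iter_comm {A B : Type*} [CommRing A] [CommRing B]
    (D : WittVector p A →+ WittVector p B)
    (hF : ∀ x, D (WittVector.frobenius x) = WittVector.frobenius (D x)) (n : ℕ)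
    (x : WittVector p A) :
    D ((⇑(WittVector.frobenius (p := p) (R := A)))^[n] x)
      = (⇑(WittVector.frobenius (p := p) (R := B)))^[n] (D x) := by
  induction n generalizing x with
  | zero => rfl
  | succ n ih => rw [Function.iterate_succ_apply, Function.iterate_succ_apply, ih, hF]

theorem cechAux_frob_surj {A : Type*} [CommRing A] (hp : (p : A) = 0)
    (h : ∀ a : A, ∃ b, b ^ p = a) :
    Function.Surjective (WittVector.frobenius (p := p) (R := A)) := by
  intro x
  rcases subsingleton_or_nontrivial A with hA | hA
  · exact ⟨0, by ext n; exact Subsingleton.elim _ _⟩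
  · have : CharP A p := (CharP.charP_iff_prime_eq_zero Fact.out).2 hp
    choose r hr using h
    refine ⟨WittVector.mk p fun n => r (x.coeff n), ?_⟩
    ext n
    rw [WittVector.coeff_frobenius_charP]
    exact hr _

theorem cechAux_ker_exact {Z A B : Type u} [CommRing Z] [CommRing A] [CommRing B]
    (C : WittVector p Z →+ WittVector p A) (D : WittVector p A →+ WittVector p B)
    (hCF : ∀ x, C (WittVector.frobenius x) = WittVector.frobenius (C x))
    (hDF : ∀ x, D (WittVector.frobenius x) = WittVector.frobenius (D x))
    (hDC : ∀ x, D (C x) = 0)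
    (hex : ∀ x, D x = 0 → ∃ y, C y = x)
    (hs : Function.Surjective (WittVector.frobenius (p := p) (R := Z)))
    (n : ℕ) (x : WittVector p B) (hx : InKerFrobeniusPow p n x) (hr : ∃ y, D y = x) :
    ∃ y, InKerFrobeniusPow p n y ∧ D y = x := by
  obtain ⟨y, rfl⟩ := hr
  unfold InKerFrobeniusPow at hx
  rw [← cechAux_iter_comm D hDF] at hx
  obtain ⟨z, hz⟩ := hex _ hx
  obtain ⟨z', rfl⟩ := (hs.iterate n) z
  refine ⟨y - C z', ?_, by rw [map_sub, hDC, sub_zero]⟩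
  unfold InKerFrobeniusPow
  rw [cechAux_iter_comm C hCF] at hz
  have : ∀ u v : WittVector p A, (⇑(WittVector.frobenius (p := p) (R := A)))^[n] (u - v)
      = (⇑(WittVector.frobenius (p := p) (R := A)))^[n] u
        - (⇑(WittVector.frobenius (p := p) (R := A)))^[n] v := fun u v =>
    iterate_map_sub (WittVector.frobenius (p := p) (R := A)) n u v
  rw [this, hz, sub_self]

end Witt


section Cech

variable (R' : Type u) [CommRing R'] [Algebra R R']

theorem cechIns_last (n : ℕ) :
    cechIns (R := R) R' (n + 1) (Fin.last _) = Algebra.TensorProduct.includeLeft := by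
  rw [cechIns]
  exact Fin.lastCases_last

theorem cechIns_castSucc (n : ℕ) (j : Fin (n + 2)) :
    cechIns (R := R) R' (n + 1) j.castSucc
      = Algebra.TensorProduct.map (cechIns R' n j) (AlgHom.id R R') := by
  rw [cechIns]
  exact Fin.lastCases_castSucc _

theorem cechIns_zero_zero :
    cechIns (R := R) R' 0 0 = Algebra.TensorProduct.includeRight := rfl

theorem cechIns_zero_one :
    cechIns (R := R) R' 0 1 = Algebra.TensorProduct.includeLeft := rfl

theorem cechAux_map_comp {A B C D T : Type*} [CommRing A] [CommRing B] [CommRing C] [CommRing D]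
    [CommRing T] [Algebra R A] [Algebra R B] [Algebra R C] [Algebra R D] [Algebra R T]
    (f : A →ₐ[R] B) (g : B →ₐ[R] D) (f' : A →ₐ[R] C) (g' : C →ₐ[R] D)
    (h : ∀ x, g (f x) = g' (f' x)) (x : A ⊗[R] T) :
    Algebra.TensorProduct.map g (AlgHom.id R T) (Algebra.TensorProduct.map f (AlgHom.id R T) x)
      = Algebra.TensorProduct.map g' (AlgHom.id R T)
          (Algebra.TensorProduct.map f' (AlgHom.id R T) x) := by
  induction x with
  | zero => simp
  | add x y hx hy => simp only [map_add, hx, hy]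
  | tmul a t => simp [h]

theorem cechAux_incl {A B T : Type*} [CommRing A] [CommRing B]
    [CommRing T] [Algebra R A] [Algebra R B] [Algebra R T]
    (f : A →ₐ[R] B) (x : A) :
    (Algebra.TensorProduct.includeLeft : B →ₐ[R] B ⊗[R] T) (f x)
      = Algebra.TensorProduct.map f (AlgHom.id R T)
          ((Algebra.TensorProduct.includeLeft : A →ₐ[R] A ⊗[R] T) x) := by
  simp

theorem cechAux_inclR {A B T : Type*} [CommRing A] [CommRing B]
    [CommRing T] [Algebra R A] [Algebra R B] [Algebra R T]
    (f g : A →ₐ[R] B) (x : T) :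
    Algebra.TensorProduct.map f (AlgHom.id R T)
        ((Algebra.TensorProduct.includeRight : T →ₐ[R] A ⊗[R] T) x)
      = Algebra.TensorProduct.map g (AlgHom.id R T)
          ((Algebra.TensorProduct.includeRight : T →ₐ[R] A ⊗[R] T) x) := by
  simp

theorem cechIns_comp (m : ℕ) : ∀ (i j : Fin (m + 2)), i ≤ j → ∀ x,
    cechIns (R := R) R' (m + 1) j.succ (cechIns (R := R) R' m i x)
      = cechIns (R := R) R' (m + 1) i.castSucc (cechIns (R := R) R' m j x) := by
  induction m with
  | zero =>
    intro i j hij x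
    induction j using Fin.lastCases with
    | last =>
      rw [Fin.succ_last, cechIns_last, cechIns_castSucc]
      exact cechAux_incl (T := R') (cechIns (R := R) R' 0 i) x
    | cast j =>
      have hj : j = 0 := Subsingleton.elim _ _
      subst hj
      have hi : i = 0 := le_antisymm hij (Fin.zero_le _)
      subst hi
      rw [show (Fin.castSucc (0 : Fin 1)).succ = (1 : Fin 2).castSucc from rfl,
        cechIns_castSucc, cechIns_castSucc]
      exact cechAux_inclR (T := R') (cechIns (R := R) R' 0 1) (cechIns (R := R) R' 0 0) x
  | succ m ih =>
    intro i j hij x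
    induction j using Fin.lastCases with
    | last =>
      rw [Fin.succ_last, cechIns_last R' (m + 1), cechIns_castSucc R' (m + 1) i,
        cechIns_last R' m]
      exact cechAux_incl (T := R') (cechIns (R := R) R' (m + 1) i) x
    | cast j =>
      induction i using Fin.lastCases with
      | last => exact absurd hij (by simp [Fin.le_def])
      | cast i =>
        rw [Fin.succ_castSucc]
        rw [cechIns_castSucc R' (m + 1) j.succ, cechIns_castSucc R' m i,
          cechIns_castSucc R' (m + 1) i.castSucc, cechIns_castSucc R' m j]
        exact cechAux_map_comp (T := R') _ _ _ _ (ih i j (by simpa using hij)) x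

noncomputable def cechLin (m : ℕ) :
    (cechAlg (R := R) R' m).carrier →ₗ[R] (cechAlg (R := R) R' (m + 1)).carrier :=
  ∑ i : Fin (m + 2), (-1 : R) ^ (i : ℕ) • (cechIns (R := R) R' m i).toLinearMap

theorem cechLin_apply (m : ℕ) (x) : cechLin (R := R) R' m x =
    ∑ i : Fin (m + 2), (-1 : R) ^ (i : ℕ) • cechIns (R := R) R' m i x := by
  simp [cechLin, LinearMap.sum_apply]

theorem cechLin_apply_int (m : ℕ) (x) : cechLin (R := R) R' m x =
    ∑ i : Fin (m + 2), (-1 : ℤ) ^ (i : ℕ) • cechIns (R := R) R' m i x := by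
  rw [cechLin_apply]
  refine Finset.sum_congr rfl fun i _ => ?_
  rw [← Int.cast_smul_eq_zsmul R]
  push_cast
  rfl

theorem cechLin_comp (m : ℕ) (x) : cechLin (R := R) R' (m + 1) (cechLin (R := R) R' m x) = 0 := by
  have := cechAux_dd m (fun i => (cechIns (R := R) R' m i).toLinearMap.toAddMonoidHom)
    (fun i => (cechIns (R := R) R' (m + 1) i).toLinearMap.toAddMonoidHom)
    (fun i j h x => cechIns_comp R' m i j h x) x
  simp only [AddMonoidHom.finsetSum_apply, AddMonoidHom.smul_apply] at this
  simp only [cechLin_apply_int]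
  exact this

theorem cechAux_sum_map {ι A B T : Type*} [CommRing A] [CommRing B]
    [CommRing T] [Algebra R A] [Algebra R B] [Algebra R T] (s : Finset ι) (c : ι → R)
    (f : ι → A →ₐ[R] B) (x : A ⊗[R] T) :
    ∑ i ∈ s, c i • Algebra.TensorProduct.map (f i) (AlgHom.id R T) x
      = (∑ i ∈ s, c i • (f i).toLinearMap).rTensor T x := by
  induction x with
  | zero => simp
  | add x y hx hy => simp only [map_add, smul_add, Finset.sum_add_distrib, hx, hy]
  | tmul a t =>
    simp [LinearMap.sum_apply, TensorProduct.sum_tmul, TensorProduct.smul_tmul']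

noncomputable def cechLinA (m : ℕ) :
    (cechAlg (R := R) R' m).carrier →ₗ[R] (cechAlg (R := R) R' m).carrier ⊗[R] R' :=
  cechLin (R := R) R' m

noncomputable def cechLinB (m : ℕ) :
    (cechAlg (R := R) R' m).carrier ⊗[R] R' →ₗ[R]
      ((cechAlg (R := R) R' m).carrier ⊗[R] R') ⊗[R] R' :=
  cechLin (R := R) R' (m + 1)

noncomputable def cechLinZ : R' →ₗ[R] R' ⊗[R] R' :=
  cechLin (R := R) R' 0

theorem cechLin_succ (m : ℕ) (x : (cechAlg (R := R) R' m).carrier ⊗[R] R') :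
    cechLinB (R := R) R' m x = (cechLinA (R := R) R' m).rTensor R' x
      + (-1 : R) ^ (m + 2) • (x ⊗ₜ[R] (1 : R')) := by
  have h := cechLin_apply (R := R) R' (m + 1) x
  rw [Fin.sum_univ_castSucc] at h
  simp only [cechIns_castSucc, cechIns_last, Fin.val_castSucc, Fin.val_last] at h
  refine h.trans ?_
  refine congrArg₂ (· + ·) ?_ rfl
  exact cechAux_sum_map (T := R') Finset.univ (fun i : Fin (m + 2) => (-1 : R) ^ (i : ℕ))
    (cechIns (R := R) R' m) x

theorem cechAux_exact_of_homotopy {P Q T B : Type*} [AddCommGroup P] [AddCommGroup Q]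
    [AddCommGroup T] [Module R P] [Module R Q] [Module R T] [CommRing B] [Algebra R B]
    [Module.FaithfullyFlat R B] (d : P →ₗ[R] Q) (e : Q →ₗ[R] T) (hed : ∀ x, e (d x) = 0)
    (σ : Q ⊗[R] B →ₗ[R] P ⊗[R] B) (τ : T ⊗[R] B →ₗ[R] Q ⊗[R] B) (ε : R) (hε : ε * ε = 1)
    (h : ∀ x, τ (e.rTensor B x) = d.rTensor B (σ x) + ε • x) (x : Q) (hx : e x = 0) :
    ∃ y, d y = x := by
  have hex : Function.Exact (d.rTensor B) (e.rTensor B) := by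
    intro y
    constructor
    · intro hy
      have h1 := h y
      rw [hy, map_zero] at h1
      refine ⟨-(ε • σ y), ?_⟩
      have h2 : d.rTensor B (σ y) = -(ε • y) := eq_neg_of_add_eq_zero_left h1.symm
      rw [map_neg, map_smul, h2, smul_neg, neg_neg, smul_smul, hε, one_smul]
    · rintro ⟨z, rfl⟩
      rw [← LinearMap.comp_apply, ← LinearMap.rTensor_comp,
        show e ∘ₗ d = 0 from LinearMap.ext hed]
      simp
  exact ((Module.FaithfullyFlat.rTensor_exact_iff_exact R B d e).1 hex x).1 hx

noncomputable def cechMul (P B : Type*) [AddCommGroup P] [Module R P] [CommRing B] [Algebra R B] :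
    (P ⊗[R] B) ⊗[R] B →ₗ[R] P ⊗[R] B :=
  (LinearMap.mul' R B).lTensor P ∘ₗ (TensorProduct.assoc R P B B).toLinearMap

theorem cechMul_tmul {P B : Type*} [AddCommGroup P] [Module R P] [CommRing B] [Algebra R B]
    (x : P) (b c : B) : cechMul (R := R) P B ((x ⊗ₜ b) ⊗ₜ c) = x ⊗ₜ (b * c) := by
  simp [cechMul]

theorem cechMul_rTensor {P Q B : Type*} [AddCommGroup P] [Module R P] [AddCommGroup Q] [Module R Q]
    [CommRing B] [Algebra R B] (d : P →ₗ[R] Q) (x : (P ⊗[R] B) ⊗[R] B) :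
    cechMul (R := R) Q B ((d.rTensor B).rTensor B x) = d.rTensor B (cechMul (R := R) P B x) := by
  induction x with
  | zero => simp
  | add x y hx hy => simp only [map_add, hx, hy]
  | tmul a c =>
    induction a with
    | zero => simp
    | add x y hx hy => simp only [map_add, hx, hy, TensorProduct.add_tmul]
    | tmul a b => simp [cechMul_tmul]

theorem cechAux_exact_succ {P B : Type*} [AddCommGroup P] [Module R P] [CommRing B] [Algebra R B]
    [Module.FaithfullyFlat R B] (d : P →ₗ[R] P ⊗[R] B)
    (e : P ⊗[R] B →ₗ[R] (P ⊗[R] B) ⊗[R] B) (hed : ∀ x, e (d x) = 0) (ε : R) (hε : ε * ε = 1)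
    (he : ∀ x, e x = d.rTensor B x + ε • (x ⊗ₜ[R] (1 : B))) (x : P ⊗[R] B) (hx : e x = 0) :
    ∃ y, d y = x := by
  refine cechAux_exact_of_homotopy (B := B) d e hed (cechMul (R := R) P B)
    (cechMul (R := R) (P ⊗[R] B) B) ε hε ?_ x hx
  intro y
  induction y with
  | zero => simp
  | add x y hx hy => simp only [map_add, hx, hy, smul_add]; abel
  | tmul a c =>
    rw [LinearMap.rTensor_tmul, he, TensorProduct.add_tmul, map_add, ← LinearMap.rTensor_tmul,
      cechMul_rTensor, ← TensorProduct.smul_tmul', map_smul, cechMul_tmul, one_mul]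

theorem cechLin_exact [Module.FaithfullyFlat R R'] (m : ℕ)
    (x : (cechAlg (R := R) R' (m + 1)).carrier) (hx : cechLin (R := R) R' (m + 1) x = 0) :
    ∃ y, cechLin (R := R) R' m y = x :=
  cechAux_exact_succ (P := (cechAlg (R := R) R' m).carrier) (B := R') (cechLinA (R := R) R' m)
    (cechLinB (R := R) R' m) (cechLin_comp R' m) ((-1) ^ (m + 2))
    (by rw [← mul_pow]; simp) (cechLin_succ R' m) x hx

theorem cechLin_zero (x : R') :
    cechLinZ (R := R) R' x = (1 : R') ⊗ₜ[R] x - x ⊗ₜ[R] (1 : R') := by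
  have h := cechLin_apply (R := R) R' 0 x
  rw [Fin.sum_univ_two] at h
  refine h.trans ?_
  rw [cechIns_zero_zero, cechIns_zero_one, sub_eq_add_neg]
  refine congrArg₂ (· + ·) ?_ ?_
  · refine Eq.trans ?_ (one_smul R _)
    exact congrArg (· • _) (pow_zero (-1 : R))
  · refine Eq.trans ?_ (neg_one_smul R _)
    exact congrArg (· • _) (pow_one (-1 : R))

theorem cechAux_exact_zero {B : Type*} [CommRing B] [Algebra R B]
    [Module.FaithfullyFlat R B] (e : B →ₗ[R] B ⊗[R] B)
    (he : ∀ x, e x = (1 : B) ⊗ₜ[R] x - x ⊗ₜ[R] (1 : B)) (x : B) (hx : e x = 0) :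
    ∃ y, algebraMap R B y = x := by
  refine cechAux_exact_of_homotopy (B := B) (Algebra.linearMap R B) e ?_
    ((TensorProduct.lid R B).symm.toLinearMap ∘ₗ LinearMap.mul' R B)
    (cechMul (R := R) B B) (-1) (by norm_num) ?_ x hx
  · intro r
    rw [he, Algebra.linearMap_apply, Algebra.algebraMap_eq_smul_one, TensorProduct.tmul_smul,
      TensorProduct.smul_tmul', sub_self]
  · intro y
    induction y with
    | zero => simp
    | add x y hx hy => simp only [map_add, hx, hy, smul_add]; abel
    | tmul a c =>
      rw [LinearMap.rTensor_tmul, he, TensorProduct.sub_tmul, map_sub, cechMul_tmul, cechMul_tmul]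
      simp [sub_eq_add_neg]

theorem cechLin_exact_zero [Module.FaithfullyFlat R R']
    (x : (cechAlg (R := R) R' 0).carrier) (hx : cechLin (R := R) R' 0 x = 0) :
    ∃ y, algebraMap R R' y = x :=
  cechAux_exact_zero (B := R') (cechLinZ (R := R) R') (cechLin_zero R') x hx


theorem cechAux_tensor_semiperfect {p : ℕ} [Fact p.Prime] {A B : Type*} [CommRing A] [CommRing B]
    [Algebra R A] [Algebra R B] (hp : (p : R) = 0)
    (hA : ∀ a : A, ∃ b, b ^ p = a) (hB : ∀ a : B, ∃ b, b ^ p = a) (x : A ⊗[R] B) :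
    ∃ y, y ^ p = x := by
  rcases subsingleton_or_nontrivial (A ⊗[R] B) with h | h
  · exact ⟨0, Subsingleton.elim _ _⟩
  have : CharP (A ⊗[R] B) p := (CharP.charP_iff_prime_eq_zero Fact.out).2 (by
    rw [← map_natCast (algebraMap R (A ⊗[R] B)), hp, map_zero])
  induction x with
  | zero => exact ⟨0, zero_pow (Fact.out : p.Prime).ne_zero⟩
  | add x y hx hy =>
    obtain ⟨a, rfl⟩ := hx
    obtain ⟨b, rfl⟩ := hy
    exact ⟨a + b, add_pow_char _ _ _⟩
  | tmul a b =>
    obtain ⟨a, rfl⟩ := hA a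
    obtain ⟨b, rfl⟩ := hB b
    exact ⟨a ⊗ₜ b, Algebra.TensorProduct.tmul_pow _ _ _⟩

theorem cechAlg_semiperfect {p : ℕ} [Fact p.Prime] (hp : (p : R) = 0)
    (hB : ∀ a : R', ∃ b, b ^ p = a) (m : ℕ) :
    ∀ x : (cechAlg (R := R) R' m).carrier, ∃ y, y ^ p = x := by
  induction m with
  | zero => exact hB
  | succ m ih => exact cechAux_tensor_semiperfect (R := R) hp ih hB

theorem cechAlg_frob_surj {p : ℕ} [Fact p.Prime] (hp : (p : R) = 0)
    (hB : ∀ a : R', ∃ b, b ^ p = a) (m : ℕ) :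
    Function.Surjective
      (WittVector.frobenius (p := p) (R := (cechAlg (R := R) R' m).carrier)) :=
  cechAux_frob_surj (by
    rw [← map_natCast (algebraMap R (cechAlg (R := R) R' m).carrier), hp, map_zero])
    (cechAlg_semiperfect R' hp hB m)


variable (p : ℕ) [Fact p.Prime]

theorem cechWittD_apply (m : ℕ) (x) : cechWittD (R := R) p R' m x =
    ∑ i : Fin (m + 2), (-1 : ℤ) ^ (i : ℕ) •
      WittVector.map (p := p) ((cechIns (R := R) R' m i) : _ →+* _) x := by
  simp only [cechWittD, AddMonoidHom.finsetSum_apply, AddMonoidHom.smul_apply]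
  rfl

theorem cechWittD_comp (m : ℕ) (x) :
    cechWittD (R := R) p R' (m + 1) (cechWittD (R := R) p R' m x) = 0 := by
  refine cechAux_dd m _ _ ?_ x
  intro i j h x
  ext n
  exact cechIns_comp R' m i j h (x.coeff n)

theorem cechWittD_coeff (m : ℕ) (x) :
    (cechWittD (R := R) p R' m x).coeff 0 = cechLin (R := R) R' m (x.coeff 0) := by
  rw [cechWittD_apply, cechLin_apply_int]
  change WittVector.constantCoeff (p := p) _ = _
  rw [map_sum]
  simp only [map_zsmul]
  rfl

theorem cechWittD_versch (m : ℕ) (x) :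
    cechWittD (R := R) p R' m (WittVector.verschiebung x)
      = WittVector.verschiebung (cechWittD (R := R) p R' m x) := by
  simp only [cechWittD_apply, map_sum, map_zsmul, WittVector.map_verschiebung]

theorem cechAux_map_frob {A B : Type u} [CommRing A] [CommRing B] (f : A →+* B)
    (x : WittVector p A) :
    WittVector.map f (WittVector.frobenius x) = WittVector.frobenius (WittVector.map f x) :=
  WittVector.IsPoly.map (WittVector.frobenius_isPoly p) f x

theorem cechWittD_frob (m : ℕ) (x) :
    cechWittD (R := R) p R' m (WittVector.frobenius x)
      = WittVector.frobenius (cechWittD (R := R) p R' m x) := by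
  simp only [cechWittD_apply, map_sum, map_zsmul, cechAux_map_frob]

theorem cechAux_aug (x : WittVector p R) :
    cechWittD (R := R) p R' 0
      (WittVector.map (algebraMap R (cechAlg (R := R) R' 0).carrier) x) = 0 := by
  rw [cechWittD_apply, Fin.sum_univ_two]
  have : WittVector.map (p := p) ((cechIns (R := R) R' 0 0) :
          (cechAlg (R := R) R' 0).carrier →+* (cechAlg (R := R) R' (0 + 1)).carrier)
        (WittVector.map (algebraMap R (cechAlg (R := R) R' 0).carrier) x)
      = WittVector.map (p := p) ((cechIns (R := R) R' 0 1) :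
          (cechAlg (R := R) R' 0).carrier →+* (cechAlg (R := R) R' (0 + 1)).carrier)
        (WittVector.map (algebraMap R (cechAlg (R := R) R' 0).carrier) x) := by
    ext n
    exact ((cechIns (R := R) R' 0 0).commutes (x.coeff n)).trans
      ((cechIns (R := R) R' 0 1).commutes (x.coeff n)).symm
  rw [this]
  simp

end Cech

theorem wittKerFrobenius_cech_acyclic_of_semiperfect (p : ℕ) [Fact p.Prime] (n : ℕ)
    (hn : 1 ≤ n) (R R' : Type u) [CommRing R] [CommRing R'] [Algebra R R']
    [CharP R p] [CharP R' p]
    (hR : Function.Surjective fun x : R => x ^ p)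
    (hR' : Function.Surjective fun x : R' => x ^ p)
    [Module.FaithfullyFlat R R'] :
    -- the differentials preserve the subgroups `W(-)[Fⁿ]`
    (∀ x : WittVector p R, InKerFrobeniusPow p n x →
        InKerFrobeniusPow p n (WittVector.map (algebraMap R R') x)) ∧
    (∀ (m : ℕ) (x : WittVector p (cechAlg (R := R) R' m).carrier), InKerFrobeniusPow p n x →
        InKerFrobeniusPow p n (cechWittD p R' m x)) ∧
    -- exactness at the augmentation term
    (∀ x : WittVector p R, InKerFrobeniusPow p n x →
        WittVector.map (algebraMap R R') x = 0 → x = 0) ∧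
    -- exactness at the degree 0 term
    (∀ x : WittVector p (cechAlg (R := R) R' 0).carrier, InKerFrobeniusPow p n x →
        (cechWittD p R' 0 x = 0 ↔
          ∃ y : WittVector p R, InKerFrobeniusPow p n y ∧
            WittVector.map (algebraMap R R') y = x)) ∧
    -- exactness at the higher terms
    (∀ (m : ℕ) (x : WittVector p (cechAlg (R := R) R' (m + 1)).carrier),
        InKerFrobeniusPow p n x →
        (cechWittD p R' (m + 1) x = 0 ↔
          ∃ y, InKerFrobeniusPow p n y ∧ cechWittD p R' m y = x)) := by
  have hp : (p : R) = 0 := CharP.cast_eq_zero R p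
  have hinjR : Function.Injective (algebraMap R R') := FaithfulSMul.algebraMap_injective R R'
  let C : WittVector p R →+ WittVector p (cechAlg (R := R) R' 0).carrier :=
    (WittVector.map (p := p) (algebraMap R R')).toAddMonoidHom
  have hCF : ∀ x, C (WittVector.frobenius x) = WittVector.frobenius (C x) :=
    fun x => cechAux_map_frob p (algebraMap R R') x
  have hCV : ∀ x, C (WittVector.verschiebung x) = WittVector.verschiebung (C x) :=
    fun x => WittVector.map_verschiebung (algebraMap R R') x
  have hC0 : ∀ x, (C x).coeff 0 = algebraMap R R' (x.coeff 0) := fun x => rfl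
  have hDC : ∀ x, cechWittD p R' 0 (C x) = 0 := cechAux_aug R' p
  have hCinj : ∀ x, C x = 0 → x = 0 := cechAux_witt_inj C (algebraMap R R')
    (fun a ha => hinjR (ha.trans (map_zero _).symm)) hC0 hCV
  have hex0 : ∀ x, cechWittD p R' 0 x = 0 → ∃ y, C y = x :=
    cechAux_witt_exact C (cechWittD p R' 0) (algebraMap R R') (cechLin (R := R) R' 0)
      (cechLin_exact_zero R') hC0 (cechWittD_coeff R' p 0) hCV (cechWittD_versch R' p 0) hDC
  have hex : ∀ m x, cechWittD (R := R) p R' (m + 1) x = 0 → ∃ y, cechWittD p R' m y = x :=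
    fun m => cechAux_witt_exact (cechWittD p R' m) (cechWittD p R' (m + 1))
      (cechLin (R := R) R' m) (cechLin (R := R) R' (m + 1)) (cechLin_exact R' m)
      (cechWittD_coeff R' p m) (cechWittD_coeff R' p (m + 1)) (cechWittD_versch R' p m)
      (cechWittD_versch R' p (m + 1)) (cechWittD_comp R' p m)
  refine ⟨?_, ?_, ?_, ?_, ?_⟩
  · intro x hx
    exact (cechAux_iter_comm C hCF n x).symm.trans ((congrArg C hx).trans (map_zero C))
  · intro m x hx
    exact (cechAux_iter_comm _ (cechWittD_frob R' p m) n x).symm.trans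
      ((congrArg _ hx).trans (map_zero _))
  · intro x _ hx
    exact hCinj x hx
  · intro x hx
    constructor
    · intro h
      obtain ⟨y, hy⟩ := hex0 x h
      refine ⟨y, hCinj _ ?_, hy⟩
      rw [cechAux_iter_comm C hCF n y, hy]
      exact hx
    · rintro ⟨y, -, hy⟩
      rw [← hy]
      exact hDC y
  · intro m x hx
    constructor
    · intro h
      cases m with
      | zero =>
        exact cechAux_ker_exact C (cechWittD p R' 0) hCF (cechWittD_frob R' p 0) hDC hex0
          (cechAux_frob_surj hp hR) n x hx (hex 0 x h)
      | succ m =>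
        exact cechAux_ker_exact (cechWittD p R' m) (cechWittD p R' (m + 1)) (cechWittD_frob R' p m)
          (cechWittD_frob R' p (m + 1)) (cechWittD_comp R' p m) (hex m)
          (cechAlg_frob_surj R' hp hR' m) n x hx (hex (m + 1) x h)
    · rintro ⟨y, -, rfl⟩
      exact cechWittD_comp R' p m y
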